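/- Reduction does not lengthen continuations: for continuations K and K', if K ≻̇ K' then |K| ≥ |K'|, where |K| is the number of frames of K. -/

import Mathlib

/-!
Metalanguage for algebraic effects (Moggi-style `let` + effect/function symbols),
with the Recursive Path Ordering, following the paper.

Terms use de Bruijn indices.  A signature assigns each rewritable symbol an
arity, tells whether it is an effect symbol or a function symbol, and (for
function symbols) gives argument types and a result type.
-/

/-- Types of the metalanguage: base types, effect (computation) types `E T`,
and arrow types. -/
inductive Ty (B : Type) : Type where
  | base : B → Ty B
  | eff : Ty B → Ty B
  | arrow : Ty B → Ty B → Ty B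

/-- A signature of rewritable symbols. -/
structure Signature (Sym B : Type) : Type where
  arity : Sym → ℕ
  isEffect : Sym → Prop
  argTy : (γ : Sym) → Fin (arity γ) → Ty B
  resTy : Sym → Ty B

/-- Terms of the metalanguage (de Bruijn indices):
variables, λ-abstraction, application, `pure`, symbol application, and `let`. -/
inductive Tm {Sym B : Type} (Sg : Signature Sym B) : Type where
  | var : ℕ → Tm Sg
  | lam : Tm Sg → Tm Sg
  | app : Tm Sg → Tm Sg → Tm Sg
  | pure : Tm Sg → Tm Sg
  | sym : (γ : Sym) → (Fin (Sg.arity γ) → Tm Sg) → Tm Sg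
  | letin : Tm Sg → Tm Sg → Tm Sg

namespace Tm

variable {Sym B : Type} {Sg : Signature Sym B}

/-- Lift a renaming under a binder. -/
def upRen (ρ : ℕ → ℕ) : ℕ → ℕ
  | 0 => 0
  | n + 1 => ρ n + 1

/-- Renaming of de Bruijn variables. -/
def rename (ρ : ℕ → ℕ) : Tm Sg → Tm Sg
  | .var n => .var (ρ n)
  | .lam u => .lam (u.rename (upRen ρ))
  | .app s t => .app (s.rename ρ) (t.rename ρ)
  | .pure t => .pure (t.rename ρ)
  | .sym γ ts => .sym γ (fun i => (ts i).rename ρ)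
  | .letin t u => .letin (t.rename ρ) (u.rename (upRen ρ))

/-- Lift a substitution under a binder. -/
def upSub (σ : ℕ → Tm Sg) : ℕ → Tm Sg
  | 0 => .var 0
  | n + 1 => (σ n).rename Nat.succ

/-- Simultaneous (capture-avoiding) substitution. -/
def subst (σ : ℕ → Tm Sg) : Tm Sg → Tm Sg
  | .var n => σ n
  | .lam u => .lam (u.subst (upSub σ))
  | .app s t => .app (s.subst σ) (t.subst σ)
  | .pure t => .pure (t.subst σ)
  | .sym γ ts => .sym γ (fun i => (ts i).subst σ)
  | .letin t u => .letin (t.subst σ) (u.subst (upSub σ))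

/-- `subst0 t u` is `u{t/x}`: substitute `t` for the outermost variable of `u`. -/
def subst0 (t : Tm Sg) (u : Tm Sg) : Tm Sg :=
  u.subst (fun n => match n with | 0 => t | n + 1 => .var n)

/-- `FreeIn x t`: the de Bruijn variable `x` occurs free in `t`. -/
def FreeIn : Tm Sg → ℕ → Prop
  | .var n, x => x = n
  | .lam u, x => u.FreeIn (x + 1)
  | .app s t, x => s.FreeIn x ∨ t.FreeIn x
  | .pure t, x => t.FreeIn x
  | .sym _ ts, x => ∃ i, (ts i).FreeIn x
  | .letin t u, x => t.FreeIn x ∨ u.FreeIn (x + 1)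

end Tm

/-- The recursive path ordering `s ≻ t` generated by a precedence `gt` on symbols:
(1) same head symbol, lexicographically smaller arguments, and `s` dominates every
argument of `t`; (2) smaller head symbol and `s` dominates every argument of `t`;
(3) some argument `sᵢ` of `s` satisfies `sᵢ ⪰ t`. -/
inductive RPO {Sym B : Type} {Sg : Signature Sym B} (gt : Sym → Sym → Prop) :
    Tm Sg → Tm Sg → Prop where
  | lexArgs {γ : Sym} {s t : Fin (Sg.arity γ) → Tm Sg} (i : Fin (Sg.arity γ))
      (hpre : ∀ j, j < i → s j = t j) (hlt : RPO gt (s i) (t i))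
      (hdom : ∀ j, RPO gt (.sym γ s) (t j)) :
      RPO gt (.sym γ s) (.sym γ t)
  | symGt {γ γ' : Sym} {s : Fin (Sg.arity γ) → Tm Sg} {t : Fin (Sg.arity γ') → Tm Sg}
      (hγ : gt γ γ') (hdom : ∀ j, RPO gt (.sym γ s) (t j)) :
      RPO gt (.sym γ s) (.sym γ' t)
  | subtermLt {γ : Sym} {s : Fin (Sg.arity γ) → Tm Sg} (i : Fin (Sg.arity γ)) {t : Tm Sg}
      (h : RPO gt (s i) t) :
      RPO gt (.sym γ s) t
  | subtermEq {γ : Sym} {s : Fin (Sg.arity γ) → Tm Sg} (i : Fin (Sg.arity γ)) {t : Tm Sg}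
      (h : s i = t) :
      RPO gt (.sym γ s) t

/-- The relation `≻̇`: the compatible closure (closure under all term contexts)
of the union of the RPO `≻` and the metalanguage rewrites `⇝ml`
(abs-β, let-β, let-assoc, eff-assoc). -/
inductive Step {Sym B : Type} {Sg : Signature Sym B} (gt : Sym → Sym → Prop) :
    Tm Sg → Tm Sg → Prop where
  | rpo {s t : Tm Sg} : RPO gt s t → Step gt s t
  | beta {u t : Tm Sg} : Step gt (.app (.lam u) t) (Tm.subst0 t u)
  | letBeta {t u : Tm Sg} : Step gt (.letin (.pure t) u) (Tm.subst0 t u)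
  | letAssoc {t₁ t₂ u : Tm Sg} :
      Step gt (.letin (.letin t₁ t₂) u)
        (.letin t₁ (.letin t₂ (u.rename (Tm.upRen Nat.succ))))
  | effAssoc {e : Sym} {ts : Fin (Sg.arity e) → Tm Sg} {u : Tm Sg} (he : Sg.isEffect e) :
      Step gt (.letin (.sym e ts) u) (.sym e fun i => .letin (ts i) u)
  | congLam {u u' : Tm Sg} : Step gt u u' → Step gt (.lam u) (.lam u')
  | congApp₁ {s s' t : Tm Sg} : Step gt s s' → Step gt (.app s t) (.app s' t)
  | congApp₂ {s t t' : Tm Sg} : Step gt t t' → Step gt (.app s t) (.app s t')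
  | congPure {t t' : Tm Sg} : Step gt t t' → Step gt (.pure t) (.pure t')
  | congSym {γ : Sym} {ts : Fin (Sg.arity γ) → Tm Sg} {i : Fin (Sg.arity γ)} {t' : Tm Sg} :
      Step gt (ts i) t' → Step gt (.sym γ ts) (.sym γ (Function.update ts i t'))
  | congLet₁ {t t' u : Tm Sg} : Step gt t t' → Step gt (.letin t u) (.letin t' u)
  | congLet₂ {t u u' : Tm Sg} : Step gt u u' → Step gt (.letin t u) (.letin t u')

/-- `SN gt t`: `t` is strongly normalizing under `≻̇` (every reduction sequence
from `t` terminates, i.e. `t` is accessible for the converse of `Step gt`). -/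
def SN {Sym B : Type} {Sg : Signature Sym B} (gt : Sym → Sym → Prop) (t : Tm Sg) : Prop :=
  Acc (fun a b => Step gt b a) t

/-- Continuations: stacks of frames `let x ⇐ [] in u`. -/
inductive Kont {Sym B : Type} (Sg : Signature Sym B) : Type where
  | nil : Kont Sg
  | cons : Kont Sg → Tm Sg → Kont Sg

namespace Kont

variable {Sym B : Type} {Sg : Signature Sym B}

/-- `K.plug t` = `K@t`: plug a term into the hole of a continuation. -/
def plug : Kont Sg → Tm Sg → Tm Sg
  | .nil, t => t
  | .cons K u, t => K.plug (.letin t u)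

/-- `|K|`: the number of frames of a continuation. -/
def len : Kont Sg → ℕ
  | .nil => 0
  | .cons K _ => K.len + 1

end Kont

/-- The reducibility predicate, by recursion on the type:
`Red B t = SN t`; `Red (S→T) s` means `s t` is reducible for every reducible `t`;
`Red (E T) t` means `K@t` is SN for every continuation `K ∈ Red_T^⊤`. -/
def Red {Sym B : Type} {Sg : Signature Sym B} (gt : Sym → Sym → Prop) :
    Ty B → Tm Sg → Prop
  | .base _, t => SN gt t
  | .arrow S T, s => ∀ t : Tm Sg, Red gt S t → Red gt T (.app s t)
  | .eff T, t => ∀ K : Kont Sg,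
      (∀ u : Tm Sg, Red gt T u → SN gt (K.plug (.pure u))) → SN gt (K.plug t)

/-- `Red_T^⊤(K)`: `K@pure(t)` is SN for every `t ∈ Red_T`. -/
def RedTop {Sym B : Type} {Sg : Signature Sym B} (gt : Sym → Sym → Prop)
    (T : Ty B) (K : Kont Sg) : Prop :=
  ∀ t : Tm Sg, Red gt T t → SN gt (K.plug (.pure t))

/-- Typing judgment `Γ ⊢ t : T` of the metalanguage (contexts are lists of types,
read by de Bruijn index).  Effect symbols take `n` arguments of a common type
`E T` and return `E T`; function symbols follow their declared signature. -/
inductive HasTy {Sym B : Type} (Sg : Signature Sym B) :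
    List (Ty B) → Tm Sg → Ty B → Prop where
  | var {Γ : List (Ty B)} {n : ℕ} {T : Ty B} :
      Γ[n]? = some T → HasTy Sg Γ (.var n) T
  | lam {Γ : List (Ty B)} {S T : Ty B} {u : Tm Sg} :
      HasTy Sg (S :: Γ) u T → HasTy Sg Γ (.lam u) (.arrow S T)
  | app {Γ : List (Ty B)} {S T : Ty B} {s t : Tm Sg} :
      HasTy Sg Γ s (.arrow S T) → HasTy Sg Γ t S → HasTy Sg Γ (.app s t) T
  | pure {Γ : List (Ty B)} {T : Ty B} {t : Tm Sg} :
      HasTy Sg Γ t T → HasTy Sg Γ (.pure t) (.eff T)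
  | letin {Γ : List (Ty B)} {S T : Ty B} {t u : Tm Sg} :
      HasTy Sg Γ t (.eff S) → HasTy Sg (S :: Γ) u (.eff T) →
      HasTy Sg Γ (.letin t u) (.eff T)
  | effSym {Γ : List (Ty B)} {T : Ty B} {e : Sym} {ts : Fin (Sg.arity e) → Tm Sg} :
      Sg.isEffect e → (∀ i, HasTy Sg Γ (ts i) (.eff T)) →
      HasTy Sg Γ (.sym e ts) (.eff T)
  | funSym {Γ : List (Ty B)} {f : Sym} {ts : Fin (Sg.arity f) → Tm Sg} :
      ¬ Sg.isEffect f → (∀ i, HasTy Sg Γ (ts i) (Sg.argTy f i)) →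
      HasTy Sg Γ (.sym f ts) (Sg.resTy f)


/-- `x` is fresh for the continuation `K`: it does not occur free in any of the
frames of `K` (tested by plugging a closed term into the hole). -/
def FreshForKont {Sym B : Type} {Sg : Signature Sym B} (x : ℕ) (K : Kont Sg) : Prop :=
  ¬ (K.plug (Tm.lam (Tm.var 0))).FreeIn x

/-- `K ≻̇ K'` for continuations: `K@x ≻̇ K'@x` for a fresh variable `x`. -/
def KontStep {Sym B : Type} {Sg : Signature Sym B} (gt : Sym → Sym → Prop)
    (K K' : Kont Sg) : Prop :=
  ∃ x : ℕ, FreshForKont x K ∧ FreshForKont x K' ∧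
    Step gt (K.plug (Tm.var x)) (K'.plug (Tm.var x))

/-- Depth of the left spine of `let`s. -/
def Tm.ldepth {Sym B : Type} {Sg : Signature Sym B} : Tm Sg → ℕ
  | .letin t _ => t.ldepth + 1
  | _ => 0

/-- The head of the left spine of `let`s is a variable. -/
def Tm.varHead {Sym B : Type} {Sg : Signature Sym B} : Tm Sg → Prop
  | .letin t _ => t.varHead
  | .var _ => True
  | _ => False

theorem Kont.ldepth_plug {Sym B : Type} {Sg : Signature Sym B} (K : Kont Sg) :
    ∀ t : Tm Sg, (K.plug t).ldepth = K.len + t.ldepth := by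
  induction K with
  | nil => intro t; simp [Kont.plug, Kont.len]
  | cons K u ih => intro t; simp only [Kont.plug, Kont.len, ih, Tm.ldepth]; omega

theorem Kont.varHead_plug {Sym B : Type} {Sg : Signature Sym B} (K : Kont Sg) :
    ∀ t : Tm Sg, t.varHead → (K.plug t).varHead := by
  induction K with
  | nil => intro t h; exact h
  | cons K u ih => intro t h; exact ih _ h

theorem Step.ldepth_le {Sym B : Type} {Sg : Signature Sym B} {gt : Sym → Sym → Prop}
    {s t : Tm Sg} (h : Step gt s t) : s.varHead → t.ldepth ≤ s.ldepth := by
  induction h with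
  | rpo h => intro hv; cases h <;> exact hv.elim
  | letAssoc => intro _; simp only [Tm.ldepth]; omega
  | congLet₁ _ ih => intro hv; have := ih hv; simp only [Tm.ldepth]; omega
  | congLet₂ _ _ => intro _; exact le_refl _
  | _ => intro hv; exact hv.elim

/-- Reduction does not lengthen continuations:
if `K ≻̇ K'` then `|K| ≥ |K'|`. -/
theorem kont_step_len {Sym B : Type} {Sg : Signature Sym B} (gt : Sym → Sym → Prop)
    (hwf : WellFounded (fun a b : Sym => gt b a)) (htrans : Transitive gt)
    (K K' : Kont Sg) (h : KontStep gt K K') : K'.len ≤ K.len := by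
  obtain ⟨x, _, _, hs⟩ := h
  have := hs.ldepth_le (K.varHead_plug _ trivial)
  simpa [Kont.ldepth_plug, Tm.ldepth] using this
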